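/- Let q ≥ 2 and k, ℓ, t ≥ 1 be fixed integers. There exists a constant A > 0 (depending only on q, k, ℓ, t) such that for every n ≥ 1 there exists a code C ⊆ Z_q^n with |C| ≥ q^n/(A·n^t) such that B_{k,t}(R_ℓ(x)) ∩ B_{k,t}(R_ℓ(x')) = ∅ for all distinct x, x' ∈ C; equivalently, there exists a code of length n over Z_q correcting t tandem duplications of length k in the ℓ-read channel with redundancy at most t·log_q n + O(1). -/

import Mathlib

/-- The composition of a word over `Fin q`, as an element of `ℤ^q`:
it counts, for each letter `a`, the number of occurrences of `a`. -/
def comp {q : ℕ} (w : List (Fin q)) : Fin q → ℤ := fun a => (w.count a : ℤ)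

/-- The `ℓ`-read vector of a word over `Fin q`: a word of length `n + ℓ - 1`
over `ℤ^q` whose `p`-th entry is the composition of the window of the last `ℓ`
symbols ending at position `p` (symbols outside the word are omitted). -/
def readVec {q : ℕ} (ℓ : ℕ) (x : List (Fin q)) : List (Fin q → ℤ) :=
  (List.range (x.length + ℓ - 1)).map fun p => comp ((x.take (p + 1)).drop (p + 1 - ℓ))

/-- The `k`-step derivative of a word over an abelian group, with the
convention that entries at nonpositive positions are `0`. -/
def kderiv {G : Type*} [AddCommGroup G] (k : ℕ) (y : List G) : List G :=
  (List.range y.length).map fun i => y.getD i 0 - if k ≤ i then y.getD (i - k) 0 else 0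

/-- The lengths `(m_0, m_1, ..., m_s)` of the maximal (possibly empty) runs of
zeros in `y = 0^{m_0} y_1 0^{m_1} ⋯ y_s 0^{m_s}` with `y_1, ..., y_s ≠ 0`. -/
def zeroRuns {G : Type*} [Zero G] [DecidableEq G] (y : List G) : List ℕ :=
  (y.splitOnP fun a => decide (a ≠ 0)).map List.length

/-- `σ_k(y) = (⌊m_0/k⌋, ⌊m_1/k⌋, ..., ⌊m_s/k⌋)`. -/
def sigmak {G : Type*} [Zero G] [DecidableEq G] (k : ℕ) (y : List G) : List ℕ :=
  (zeroRuns y).map fun m => m / k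

/-- Interleave zero runs of the given lengths with the given (nonzero) letters:
`assemble (m_0 :: ... :: m_s) (y_1 :: ... :: y_s) = 0^{m_0} y_1 0^{m_1} ⋯ y_s 0^{m_s}`. -/
def assemble {G : Type*} [Zero G] : List ℕ → List G → List G
  | [], _ => []
  | m :: _, [] => List.replicate m (0 : G)
  | m :: ms, a :: as => List.replicate m (0 : G) ++ a :: assemble ms as

/-- `μ_k(y) = 0^{m_0 % k} y_1 0^{m_1 % k} ⋯ y_s 0^{m_s % k}`. -/
def muk {G : Type*} [Zero G] [DecidableEq G] (k : ℕ) (y : List G) : List G :=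
  assemble ((zeroRuns y).map fun m => m % k) (y.filter fun a => decide (a ≠ 0))

/-- The nucleus `N_{k,ℓ}(x) = μ_k(Δ_k(R_ℓ(x)))` of a word over `Fin q`. -/
def nucleus {q : ℕ} (k ℓ : ℕ) (x : List (Fin q)) : List (Fin q → ℤ) :=
  muk k (kderiv k (readVec ℓ x))

/-- A single tandem duplication of length `k`: `u v w ↦ u v v w` with `|v| = k`. -/
def TD {α : Type*} (k : ℕ) (y z : List α) : Prop :=
  ∃ u v w : List α, v.length = k ∧ y = u ++ (v ++ w) ∧ z = u ++ (v ++ (v ++ w))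

/-- `TDt k t y z` holds iff `z` arises from `y` by a sequence of exactly `t`
tandem duplications of length `k`, i.e. `y ⟹_k^t z`. -/
def TDt {α : Type*} (k : ℕ) : ℕ → List α → List α → Prop
  | 0 => fun y z => y = z
  | t + 1 => fun y z => ∃ w, TDt k t y w ∧ TD k w z

/-- The ball `B_{k,t}(y)`: all words obtained from `y` by at most `t` tandem
duplications of length `k`. -/
def Ball {α : Type*} (k t : ℕ) (y : List α) : Set (List α) :=
  {z | ∃ j ≤ t, TDt k j y z}

/-- `x` is `(k,ℓ)`-fine: it contains no `k`-periodic factor of length `2k+ℓ-1`. -/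
def Fine {q : ℕ} (k ℓ : ℕ) (x : List (Fin q)) : Prop :=
  ∀ i : ℕ, 1 ≤ i → i + 2 * k + ℓ - 2 ≤ x.length →
    (x.drop (i - 1)).take (k + ℓ - 1) ≠ (x.drop (i - 1 + k)).take (k + ℓ - 1)

/-- `y` contains the factor `0^k` (a run of `k` consecutive zeros). -/
def HasZeroBlock {G : Type*} [Zero G] (k : ℕ) (y : List G) : Prop :=
  ∃ j, j + k ≤ y.length ∧ (y.drop j).take k = List.replicate k (0 : G)

/-- `λ_{m,q}`: the largest real root of `x^{m+2} - q·x^{m+1} + q - 1`. -/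
noncomputable def lambdaRoot (m q : ℕ) : ℝ :=
  sSup {x : ℝ | x ^ (m + 2) - (q : ℝ) * x ^ (m + 1) + (q : ℝ) - 1 = 0}

/-- The dot product `a ⊙ b = Σ_{i=1}^{min(|a|,|b|)} a_i · b_i`. -/
def dot {G : Type*} [AddCommMonoid G] (a : List ℕ) (b : List G) : G :=
  (List.zipWith (fun m g => m • g) a b).sum

section ReadVector

variable {q : ℕ}

theorem comp_append (s s' : List (Fin q)) : comp (s ++ s') = comp s + comp s' := by
  funext a
  simp [comp]

theorem comp_singleton_injective : Function.Injective fun a : Fin q => comp [a] := by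
  intro a b h
  have := congrFun h a
  simp only [comp, List.count_singleton_self, List.count_singleton] at this
  by_contra hab
  simp [Ne.symm hab] at this

theorem readVec_inj {ℓ : ℕ} (hl : 1 ≤ ℓ) {x x' : List (Fin q)} (hlen : x.length = x'.length)
    (h : readVec ℓ x = readVec ℓ x') : x = x' := by
  have window : ∀ p < x.length, comp ((x.take (p + 1)).drop (p + 1 - ℓ)) =
      comp ((x'.take (p + 1)).drop (p + 1 - ℓ)) := by
    intro p hp
    simp only [readVec, ← hlen] at h
    exact (List.map_inj_left.mp h) p (List.mem_range.mpr (by omega))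
  have take_eq : ∀ p ≤ x.length, x.take p = x'.take p := by
    intro p
    induction p with
    | zero => simp
    | succ p ih =>
      intro hp
      have hw := window p (by omega)
      have ht := ih (by omega)
      rw [List.take_succ_eq_append_getElem (by omega : p < x.length),
        List.take_succ_eq_append_getElem (by omega : p < x'.length), ← ht] at hw ⊢
      rw [List.drop_append_of_le_length (by simp; omega),
        List.drop_append_of_le_length (by simp; omega), comp_append, comp_append] at hw
      rw [comp_singleton_injective (add_left_cancel hw)]
  have := take_eq x.length le_rfl
  rwa [List.take_length, hlen, List.take_length] at this

end ReadVector

section Derivative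

variable {G : Type*} [AddCommGroup G]

theorem length_kderiv (k : ℕ) (y : List G) : (kderiv k y).length = y.length := by
  simp [kderiv]

theorem kderiv_eq_zipWith (k : ℕ) (y : List G) :
    kderiv k y = List.zipWith (· - ·) y (List.replicate k 0 ++ y) := by
  apply List.ext_getElem
  · simp [kderiv]
  · intro i h₁ h₂
    have hi : i < y.length := by simpa [kderiv] using h₁
    by_cases hik : k ≤ i
    · have : i - k < y.length := by omega
      simp [kderiv, hik, hi, this, List.getElem_append_right]
    · have : i < (List.replicate k (0 : G)).length := by simpa using hik
      simp [kderiv, hik, hi, List.getElem_append_left this]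

theorem kderiv_injective {k : ℕ} (hk : 1 ≤ k) :
    Function.Injective (kderiv k : List G → List G) := by
  intro y z h
  have hlen : y.length = z.length := by
    simpa [length_kderiv] using congrArg List.length h
  have key : ∀ i < y.length, y.getD i 0 = z.getD i 0 := by
    intro i
    induction i using Nat.strong_induction_on with
    | _ i ih =>
      intro hi
      simp only [kderiv, ← hlen] at h
      have hd := (List.map_inj_left.mp h) i (List.mem_range.mpr hi)
      by_cases hik : k ≤ i
      · rw [if_pos hik, if_pos hik, ih (i - k) (by omega) (by omega)] at hd
        exact sub_left_injective hd
      · simpa [hik] using hd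
  refine List.ext_getElem hlen fun i h₁ h₂ => ?_
  simpa [h₁, h₂] using key i h₁

/-- A tandem duplication of length `k` inserts the block `0^k` into the `k`-step derivative. -/
theorem TD.kderiv_insert {k : ℕ} {y z : List G} (h : TD k y z) :
    ∃ a b : List G, kderiv k y = a ++ b ∧ kderiv k z = a ++ (List.replicate k 0 ++ b) := by
  obtain ⟨u, v, w, rfl, rfl, rfl⟩ := h
  have hsub : List.zipWith (· - ·) v v = List.replicate v.length (0 : G) := by
    apply List.ext_getElem <;> simp
  refine ⟨List.zipWith (· - ·) (u ++ v) (List.replicate v.length 0 ++ u),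
    List.zipWith (· - ·) w (v ++ w), ?_, ?_⟩
  · rw [kderiv_eq_zipWith, ← List.zipWith_append (by simp [add_comm])]
    simp
  · rw [kderiv_eq_zipWith, ← hsub, ← List.zipWith_append rfl,
      ← List.zipWith_append (by simp [add_comm])]
    simp

end Derivative

section ZeroRuns

variable {G : Type*} [DecidableEq G]

/-- The length of the maximal run of zeros preceded by exactly `j` nonzero letters. -/
def runLength [Zero G] : List G → ℕ → ℕ
  | [], _ => 0
  | a :: y, j =>
    if a = 0 then (if j = 0 then 1 else 0) + runLength y j
    else match j with
      | 0 => 0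
      | j + 1 => runLength y j

/-- The subword of nonzero letters. -/
def support [Zero G] (y : List G) : List G := y.filter fun a => decide (a ≠ 0)

theorem eq_of_support_eq_of_runLength_eq [Zero G] : ∀ {y z : List G},
    support y = support z → (∀ j, runLength y j = runLength z j) → y = z
  | [], [], _, _ => rfl
  | [], b :: z, hs, hr => by
    by_cases hb : b = 0
    · have := hr 0
      simp only [runLength, hb, if_true] at this
      omega
    · simp [support, hb] at hs
  | a :: y, [], hs, hr => by
    by_cases ha : a = 0
    · have := hr 0
      simp [runLength, ha] at this
    · simp [support, ha] at hs
  | a :: y, b :: z, hs, hr => by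
    have h0 := hr 0
    by_cases ha : a = 0 <;> by_cases hb : b = 0
    · rw [ha, hb, eq_of_support_eq_of_runLength_eq (y := y) (z := z)
        (by simpa [support, ha, hb] using hs) (fun j => by simpa [runLength, ha, hb] using hr j)]
    · simp [runLength, ha, hb] at h0
    · simp only [runLength, ha, hb, if_true, if_false] at h0
      omega
    · obtain ⟨hab, hs'⟩ : a = b ∧ support y = support z := by simpa [support, ha, hb] using hs
      rw [hab, eq_of_support_eq_of_runLength_eq hs'
        (fun j => by simpa [runLength, ha, hb] using hr (j + 1))]

theorem support_insert_zeros [Zero G] (k : ℕ) (a b : List G) :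
    support (a ++ (List.replicate k 0 ++ b)) = support (a ++ b) := by
  simp [support]

theorem runLength_replicate_append [Zero G] (k : ℕ) (b : List G) (j : ℕ) :
    runLength (List.replicate k 0 ++ b) j = runLength b j + if j = 0 then k else 0 := by
  induction k with
  | zero => simp
  | succ k ih =>
    simp only [List.replicate_succ, List.cons_append, runLength, if_true, ih]
    split_ifs <;> omega

theorem runLength_insert_zeros [Zero G] (k : ℕ) (a b : List G) (j : ℕ) :
    runLength (a ++ (List.replicate k 0 ++ b)) j =
      runLength (a ++ b) j + if j = (support a).length then k else 0 := by
  induction a generalizing j with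
  | nil => simpa [support] using runLength_replicate_append k b j
  | cons c a ih =>
    by_cases hc : c = 0
    · simp [runLength, hc, ih, support, add_assoc]
    · have hs : support (c :: a) = c :: support a := by simp [support, hc]
      cases j with
      | zero => simp [runLength, hc, hs]
      | succ j => simp [runLength, hc, hs, ih]

/-- A sequence of `j` tandem duplications of length `k` preserves the nonzero letters of the
derivative and lengthens its zero runs, indexed by a multiset of size `j`, by `k` each. -/
theorem TDt.exists_multiset [AddCommGroup G] {k j : ℕ} {y z : List G} (h : TDt k j y z) :
    support (kderiv k z) = support (kderiv k y) ∧
      ∃ M : Multiset ℕ, M.card = j ∧ (∀ i ∈ M, i ≤ y.length) ∧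
        ∀ i, runLength (kderiv k z) i = runLength (kderiv k y) i + k * M.count i := by
  induction j generalizing z with
  | zero =>
    obtain rfl : y = z := h
    exact ⟨rfl, 0, by simp⟩
  | succ j ih =>
    obtain ⟨w, hyw, hwz⟩ := h
    obtain ⟨hs, M, hcard, hM, hrun⟩ := ih hyw
    obtain ⟨a, b, hw, hz⟩ := hwz.kderiv_insert
    refine ⟨by rw [hz, support_insert_zeros, ← hw, hs], (support a).length ::ₘ M,
      by simp [hcard], ?_, fun i => ?_⟩
    · intro i hi
      rcases Multiset.mem_cons.mp hi with rfl | hi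
      · calc (support a).length ≤ (support (a ++ b)).length := by simp [support]
          _ = (support (kderiv k y)).length := by rw [← hw, hs]
          _ ≤ y.length := (List.length_filter_le _ _).trans (length_kderiv k y).le
      · exact hM i hi
    · rw [hz, runLength_insert_zeros, ← hw, hrun, Multiset.count_cons]
      split_ifs <;> ring

end ZeroRuns

section Syndrome

open Polynomial

/-- The polynomial `1 + (i + 1) X`. -/
noncomputable def linearFactor (p i : ℕ) : (ZMod p)[X] := C ((i : ZMod p) + 1) * X + C 1

theorem coeff_zero_linearFactor (p i : ℕ) : (linearFactor p i).coeff 0 = 1 := by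
  simp [linearFactor]

theorem natDegree_prod_linearFactor_le (p : ℕ) (M : Multiset ℕ) :
    (M.map (linearFactor p)).prod.natDegree ≤ M.card := by
  refine (natDegree_multiset_prod_le _).trans ?_
  rw [Multiset.map_map]
  refine (Multiset.sum_le_card_nsmul _ 1 ?_).trans (by simp)
  intro d hd
  obtain ⟨i, -, rfl⟩ := Multiset.mem_map.mp hd
  exact natDegree_linear_le

theorem coeff_zero_prod_linearFactor_pow (p : ℕ) (s : Finset ℕ) (f : ℕ → ℕ) :
    (∏ i ∈ s, linearFactor p i ^ f i).coeff 0 = 1 := by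
  simp [coeff_zero_eq_eval_zero, eval_prod, linearFactor]

theorem natCast_add_one_injOn (p : ℕ) :
    Set.InjOn (fun i : ℕ => (i : ZMod p) + 1) {i | i + 1 < p} := by
  intro i hi j hj h
  have h' : ((i + 1 : ℕ) : ZMod p) = ((j + 1 : ℕ) : ZMod p) := by push_cast; exact h
  have := congrArg ZMod.val h'
  rw [ZMod.val_natCast_of_lt hi, ZMod.val_natCast_of_lt hj] at this
  omega

theorem roots_prod_linearFactor {p : ℕ} [Fact p.Prime] {M : Multiset ℕ}
    (hM : ∀ i ∈ M, i + 1 < p) :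
    (M.map (linearFactor p)).prod.roots = M.map fun i : ℕ => -((i : ZMod p) + 1)⁻¹ := by
  have hne : ∀ i ∈ M, (i : ZMod p) + 1 ≠ 0 := by
    intro i hi h
    have h' : ((i + 1 : ℕ) : ZMod p) = 0 := by push_cast; exact h
    have := Nat.le_of_dvd (by omega) ((ZMod.natCast_eq_zero_iff _ _).mp h')
    have := hM i hi
    omega
  rw [roots_multiset_prod, Multiset.bind_map, ← Multiset.bind_singleton]
  · refine Multiset.bind_congr fun i hi => ?_
    rw [linearFactor, roots_C_mul_X_add_C _ (hne i hi), mul_one]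
  · intro h
    obtain ⟨i, -, hi⟩ := Multiset.mem_map.mp h
    simpa [hi] using coeff_zero_linearFactor p i

theorem eq_of_prod_linearFactor_eq {p : ℕ} [Fact p.Prime] {M M' : Multiset ℕ}
    (hM : ∀ i ∈ M, i + 1 < p) (hM' : ∀ i ∈ M', i + 1 < p)
    (h : (M.map (linearFactor p)).prod = (M'.map (linearFactor p)).prod) : M = M' := by
  have hr := congrArg roots h
  rw [roots_prod_linearFactor hM, roots_prod_linearFactor hM'] at hr
  have hinj : Set.InjOn (fun i : ℕ => -((i : ZMod p) + 1)⁻¹) {i | i + 1 < p} :=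
    fun i hi j hj hij => natCast_add_one_injOn p hi hj (inv_injective (neg_injective hij))
  refine Multiset.ext.mpr fun i => ?_
  by_cases hi : i + 1 < p
  · have count_map : ∀ {N : Multiset ℕ}, (∀ j ∈ N, j + 1 < p) →
        (N.map fun i : ℕ => -((i : ZMod p) + 1)⁻¹).count (-((i : ZMod p) + 1)⁻¹) = N.count i := by
      intro N hN
      rw [Multiset.count_map, Multiset.count, Multiset.countP_eq_card_filter]
      exact congrArg _ (Multiset.filter_congr fun j hj =>
        ⟨fun h => hinj hi (hN j hj) h, fun h => by rw [h]⟩)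
    rw [← count_map hM, ← count_map hM', hr]
  · rw [Multiset.count_eq_zero.mpr fun h => hi (hM i h),
      Multiset.count_eq_zero.mpr fun h => hi (hM' i h)]

/-- Cancellation modulo `X ^ (t + 1)` determines polynomials of degree at most `t`. -/
theorem eq_of_mul_eq_mul_of_coeff_eq {F : Type*} [Field F] {t : ℕ} {P P' Q Q' : F[X]}
    (hP : P.coeff 0 ≠ 0) (hPP' : ∀ i ≤ t, P.coeff i = P'.coeff i)
    (hQ : Q.natDegree ≤ t) (hQ' : Q'.natDegree ≤ t) (h : P * Q = P' * Q') : Q = Q' := by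
  have hdvd : X ^ (t + 1) ∣ P' - P :=
    X_pow_dvd_iff.mpr fun i hi => by rw [coeff_sub, hPP' i (by omega), sub_self]
  have hmul : X ^ (t + 1) ∣ P * (Q - Q') := by
    rw [show P * (Q - Q') = (P' - P) * Q' by rw [mul_sub, h]; ring]
    exact hdvd.mul_right _
  have hQQ' := prime_X.pow_dvd_of_dvd_mul_left (t + 1) (by rwa [X_dvd_iff]) hmul
  by_contra hne
  have hle := natDegree_le_of_dvd hQQ' (sub_ne_zero.mpr hne)
  rw [natDegree_X_pow] at hle
  have := natDegree_sub_le Q Q'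
  omega

/-- The polynomial `∏ (1 + (i + 1) X) ^ ⌊m_i / k⌋`, where `m_i` is the length of the `i`-th zero
run of the derivative of `y`, over the indices `i < N`. -/
noncomputable def syndromePoly {G : Type*} [AddCommGroup G] [DecidableEq G]
    (p k N : ℕ) (y : List G) : (ZMod p)[X] :=
  ∏ i ∈ Finset.range N, linearFactor p i ^ (runLength (kderiv k y) i / k)

theorem eq_of_mem_ball_of_syndrome_eq {G : Type*} [AddCommGroup G] [DecidableEq G]
    {p k t N : ℕ} [Fact p.Prime] (hk : 1 ≤ k) (hp : N < p) {y y' z : List G}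
    (hy : y.length < N) (hy' : y'.length < N) (hz : z ∈ Ball k t y) (hz' : z ∈ Ball k t y')
    (hsynd : ∀ i < t,
      (syndromePoly p k N y).coeff (i + 1) = (syndromePoly p k N y').coeff (i + 1)) :
    y = y' := by
  obtain ⟨j, hj, h⟩ := hz
  obtain ⟨j', hj', h'⟩ := hz'
  obtain ⟨hs, M, hcard, hM, hrun⟩ := h.exists_multiset
  obtain ⟨hs', M', hcard', hM', hrun'⟩ := h'.exists_multiset
  have prod_eq : ∀ {L : Multiset ℕ}, (∀ i ∈ L, i < N) →
      (L.map (linearFactor p)).prod = ∏ i ∈ Finset.range N, linearFactor p i ^ L.count i := by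
    intro L hL
    rw [Finset.prod_multiset_map_count]
    refine Finset.prod_subset (fun i hi => Finset.mem_range.mpr (hL i (by simpa using hi))) ?_
    intro i _ hi
    rw [Multiset.count_eq_zero.mpr (by simpa using hi), pow_zero]
  have hmul : syndromePoly p k N y * (M.map (linearFactor p)).prod =
      syndromePoly p k N y' * (M'.map (linearFactor p)).prod := by
    rw [prod_eq fun i hi => (hM i hi).trans_lt hy, prod_eq fun i hi => (hM' i hi).trans_lt hy']
    simp only [syndromePoly, ← Finset.prod_mul_distrib, ← pow_add]
    refine Finset.prod_congr rfl fun i _ => ?_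
    rw [← Nat.add_mul_div_left _ _ hk, ← Nat.add_mul_div_left _ _ hk, ← hrun, ← hrun']
  have hcoeff : ∀ i ≤ t, (syndromePoly p k N y).coeff i = (syndromePoly p k N y').coeff i := by
    rintro (_ | i) hi
    · simp only [syndromePoly, coeff_zero_prod_linearFactor_pow]
    · exact hsynd i hi
  have hMM' : M = M' := by
    refine eq_of_prod_linearFactor_eq (fun i hi => ?_) (fun i hi => ?_)
      (eq_of_mul_eq_mul_of_coeff_eq (t := t) ?_ hcoeff ?_ ?_ hmul)
    · have := hM i hi
      omega
    · have := hM' i hi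
      omega
    · simp [syndromePoly, coeff_zero_prod_linearFactor_pow]
    · exact (natDegree_prod_linearFactor_le p M).trans (by omega)
    · exact (natDegree_prod_linearFactor_le p M').trans (by omega)
  refine kderiv_injective hk (eq_of_support_eq_of_runLength_eq (hs.symm.trans hs') fun i => ?_)
  have := hrun i
  rw [hrun' i, hMM'] at this
  omega

end Syndrome

/-- there is a constant `A > 0` such that for every `n ≥ 1`
there is a code `C ⊆ Z_q^n` with `|C| ≥ q^n/(A·n^t)` correcting `t` tandem
duplications of length `k` in the `ℓ`-read channel (redundancy at most
`t·log_q n + O(1)`). -/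
theorem stmt_18 (q k ℓ t : ℕ) (hq : 2 ≤ q) (hk : 1 ≤ k) (hl : 1 ≤ ℓ) (ht : 1 ≤ t) :
    ∃ A : ℝ, 0 < A ∧ ∀ n : ℕ, 1 ≤ n →
      ∃ C : Finset (Fin n → Fin q),
        (q : ℝ) ^ n / (A * (n : ℝ) ^ t) ≤ (C.card : ℝ) ∧
        ∀ x ∈ C, ∀ x' ∈ C, x ≠ x' →
          Ball k t (readVec ℓ (List.ofFn x)) ∩ Ball k t (readVec ℓ (List.ofFn x')) = ∅ := by
  refine ⟨(2 * (1 + ℓ : ℝ)) ^ t, by positivity, fun n hn => ?_⟩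
  obtain ⟨p, hprime, hlt, hle⟩ := Nat.exists_prime_lt_and_le_two_mul (n + ℓ) (by omega)
  have : Fact p.Prime := ⟨hprime⟩
  let syndrome : (Fin n → Fin q) → Fin t → ZMod p := fun x i =>
    (syndromePoly p k (n + ℓ) (readVec ℓ (List.ofFn x))).coeff (i + 1)
  have hp0 : (0 : ℝ) < p := by exact_mod_cast hprime.pos
  obtain ⟨c, hc⟩ := Fintype.exists_le_card_fiber_of_nsmul_le_card syndrome
    (b := (q : ℝ) ^ n / (p : ℝ) ^ t) (by
      have : (p : ℝ) ^ t ≠ 0 := by positivity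
      simp [ZMod.card, mul_div_cancel₀, this])
  refine ⟨Finset.univ.filter fun x => syndrome x = c, le_trans ?_ hc, ?_⟩
  · rw [← mul_pow]
    have hpn : (p : ℝ) ≤ 2 * (1 + ℓ) * n := by
      have hn' : n + ℓ ≤ (1 + ℓ) * n := by nlinarith
      calc (p : ℝ) ≤ 2 * ((n + ℓ : ℕ) : ℝ) := by exact_mod_cast hle
        _ ≤ 2 * (((1 + ℓ) * n : ℕ) : ℝ) := by gcongr
        _ = 2 * (1 + ℓ) * n := by push_cast; ring
    gcongr
  · intro x hx x' hx' hne
    simp only [Finset.mem_filter, Finset.mem_univ, true_and] at hx hx'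
    refine Set.eq_empty_iff_forall_notMem.mpr fun z hz => hne ?_
    have hlen : ∀ x : Fin n → Fin q, (readVec ℓ (List.ofFn x)).length < n + ℓ := by
      intro x
      simp only [readVec, List.length_map, List.length_range, List.length_ofFn]
      omega
    have hread := eq_of_mem_ball_of_syndrome_eq hk hlt (hlen x) (hlen x') hz.1 hz.2
      fun i hi => congrFun (hx.trans hx'.symm) ⟨i, hi⟩
    exact List.ofFn_injective (readVec_inj hl (by simp) hread)
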